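/- Assume 𝒜 ≠ 0. The set { inf_{c ∈ N} ⟨S(u + c), u + c⟩ / ⟨𝒜 u, u⟩ : u ∈ N⊥, u ≠ 0 } is bounded above; let K := 1 plus its supremum. Then K ≥ 1, and for every v ∈ ℝ^n one has ⟨𝒜 E v, E v⟩ ≤ (1 − 1/K) ⟨𝒜 v, v⟩; in particular, the Gauss–Seidel-type iteration v ↦ v + B(f − 𝒜 v) on the singular system 𝒜 x = f contracts the 𝒜-seminorm with factor at most √(1 − 1/K) < 1. -/

import Mathlib

open Matrix

namespace Matrix

lemma PosSemidef.transpose_eq {ι : Type*} {A : Matrix ι ι ℝ} (hA : A.PosSemidef) : Aᵀ = A := by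
  simpa using hA.isHermitian.eq

variable {ι : Type*} [Fintype ι]

lemma mulVec_dotProduct_eq (A : Matrix ι ι ℝ) (x y : ι → ℝ) :
    (A *ᵥ x) ⬝ᵥ y = x ⬝ᵥ (Aᵀ *ᵥ y) := by
  rw [dotProduct_mulVec, vecMul_transpose]

lemma PosSemidef.mulVec_dotProduct_nonneg {A : Matrix ι ι ℝ} (hA : A.PosSemidef) (x : ι → ℝ) :
    0 ≤ (A *ᵥ x) ⬝ᵥ x := by
  simpa [dotProduct_comm] using hA.dotProduct_mulVec_nonneg x

lemma PosSemidef.mulVec_dotProduct_eq_zero_iff {A : Matrix ι ι ℝ} (hA : A.PosSemidef)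
    (x : ι → ℝ) : (A *ᵥ x) ⬝ᵥ x = 0 ↔ A *ᵥ x = 0 := by
  simpa [dotProduct_comm] using hA.dotProduct_mulVec_zero_iff x

/-- The Cauchy–Schwarz inequality for the form of a positive semidefinite matrix. -/
lemma PosSemidef.mulVec_dotProduct_sq_le {A : Matrix ι ι ℝ} (hA : A.PosSemidef) (x y : ι → ℝ) :
    ((A *ᵥ x) ⬝ᵥ y) ^ 2 ≤ ((A *ᵥ x) ⬝ᵥ x) * ((A *ᵥ y) ⬝ᵥ y) := by
  have hsymm : (A *ᵥ y) ⬝ᵥ x = (A *ᵥ x) ⬝ᵥ y := by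
    rw [mulVec_dotProduct_eq, hA.transpose_eq, dotProduct_comm]
  have h := discrim_le_zero (a := (A *ᵥ x) ⬝ᵥ x) (b := 2 * ((A *ᵥ x) ⬝ᵥ y))
    (c := (A *ᵥ y) ⬝ᵥ y) fun t ↦ by
      have ht := hA.mulVec_dotProduct_nonneg (t • x + y)
      simp only [mulVec_add, mulVec_smul, add_dotProduct, dotProduct_add, smul_dotProduct,
        dotProduct_smul, smul_eq_mul, hsymm] at ht
      linarith
  rw [discrim] at h
  linarith

/-- Every vector splits into a vector orthogonal to the kernel of `A` and a vector in the
kernel. -/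
lemma exists_orthogonal_add_mulVec_eq_zero (A : Matrix ι ι ℝ) (v : ι → ℝ) :
    ∃ u c : ι → ℝ, (∀ d, A *ᵥ d = 0 → u ⬝ᵥ d = 0) ∧ A *ᵥ c = 0 ∧ v = u + c := by
  classical
  obtain ⟨c, hc, u, hu, hv⟩ := (LinearMap.ker (toEuclideanLin A)).exists_add_mem_mem_orthogonal
    (WithLp.toLp 2 v)
  refine ⟨u.ofLp, c.ofLp, fun d hd ↦ ?_, ?_, ?_⟩
  · have h := (Submodule.mem_orthogonal _ _).1 hu (WithLp.toLp 2 d) (by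
      simp [LinearMap.mem_ker, toLpLin_apply, hd])
    simpa [EuclideanSpace.inner_eq_star_dotProduct] using h
  · simpa [LinearMap.mem_ker, toLpLin_apply] using hc
  · rw [add_comm]
    exact congrArg WithLp.ofLp hv

lemma PosSemidef.mulVec_dotProduct_pos {A : Matrix ι ι ℝ} (hA : A.PosSemidef) {u : ι → ℝ}
    (hu : ∀ d, A *ᵥ d = 0 → u ⬝ᵥ d = 0) (hu0 : u ≠ 0) : 0 < (A *ᵥ u) ⬝ᵥ u := by
  refine (hA.mulVec_dotProduct_nonneg u).lt_of_ne' fun h ↦ hu0 ?_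
  exact dotProduct_self_eq_zero.1 (hu u ((hA.mulVec_dotProduct_eq_zero_iff u).1 h))

/-- On the orthogonal complement of the kernel of a positive semidefinite `A`, every quadratic
form is dominated by the form of `A`. -/
lemma PosSemidef.exists_div_le {A : Matrix ι ι ℝ} (hA : A.PosSemidef) (S : Matrix ι ι ℝ) :
    ∃ C : ℝ, ∀ u : ι → ℝ, (∀ d, A *ᵥ d = 0 → u ⬝ᵥ d = 0) → u ≠ 0 →
      (S *ᵥ u) ⬝ᵥ u / ((A *ᵥ u) ⬝ᵥ u) ≤ C := by
  set T : Set (ι → ℝ) := Metric.sphere 0 1 ∩ {u | ∀ d, A *ᵥ d = 0 → u ⬝ᵥ d = 0} with hT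
  have hclosed : IsClosed {u : ι → ℝ | ∀ d, A *ᵥ d = 0 → u ⬝ᵥ d = 0} := by
    simp only [Set.ofPred_forall]
    exact isClosed_iInter fun d ↦ isClosed_iInter fun _ ↦
      isClosed_eq (by fun_prop) continuous_const
  have hcompact : IsCompact T := (isCompact_sphere _ _).inter_right hclosed
  have hcont : ContinuousOn (fun u : ι → ℝ ↦ (S *ᵥ u) ⬝ᵥ u / ((A *ᵥ u) ⬝ᵥ u)) T := by
    refine ContinuousOn.div (by fun_prop) (by fun_prop) fun u hu ↦ ?_
    exact (hA.mulVec_dotProduct_pos hu.2 (ne_zero_of_mem_unit_sphere ⟨u, hu.1⟩)).ne'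
  obtain ⟨C, hC⟩ := hcompact.bddAbove_image hcont
  refine ⟨C, fun u hu hu0 ↦ ?_⟩
  have hnorm : ‖u‖ ≠ 0 := norm_ne_zero_iff.2 hu0
  have hmem : ‖u‖⁻¹ • u ∈ T := by
    refine ⟨by simp [norm_smul, hnorm], fun d hd ↦ ?_⟩
    simp [hu d hd]
  have h := hC (Set.mem_image_of_mem _ hmem)
  simp only [mulVec_smul, smul_dotProduct, dotProduct_smul, smul_eq_mul] at h
  rwa [mul_div_mul_left _ _ (inv_ne_zero hnorm), mul_div_mul_left _ _ (inv_ne_zero hnorm)] at h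

lemma splitting_mul_inv_mul_transpose [DecidableEq ι] {A D L : Matrix ι ι ℝ} (hD : D.PosDef)
    (hsplit : A = D - L - Lᵀ) :
    (D - L) * D⁻¹ * (D - L)ᵀ = A + L * D⁻¹ * Lᵀ := by
  have hdet : IsUnit D.det := (isUnit_iff_isUnit_det D).1 hD.isUnit
  rw [transpose_sub, hD.posSemidef.transpose_eq, sub_mul, mul_nonsing_inv _ hdet, sub_mul, one_mul,
    mul_sub, mul_assoc L D⁻¹ D, nonsing_inv_mul _ hdet, mul_one, hsplit]
  abel

/-- If `(D - L) w = A v`, then one Gauss–Seidel sweep `v ↦ v - w` decreases the energy by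
`⟨D w, w⟩`. -/
lemma mulVec_sub_dotProduct_sub {A D L : Matrix ι ι ℝ} (hA : A.PosSemidef)
    (hsplit : A = D - L - Lᵀ) {v w : ι → ℝ} (hw : (D - L) *ᵥ w = A *ᵥ v) :
    (A *ᵥ (v - w)) ⬝ᵥ (v - w) = (A *ᵥ v) ⬝ᵥ v - (D *ᵥ w) ⬝ᵥ w := by
  have h₁ : (A *ᵥ w) ⬝ᵥ v = (A *ᵥ v) ⬝ᵥ w := by
    rw [mulVec_dotProduct_eq, hA.transpose_eq, dotProduct_comm]
  have h₂ : (A *ᵥ v) ⬝ᵥ w = (D *ᵥ w) ⬝ᵥ w - (L *ᵥ w) ⬝ᵥ w := by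
    rw [← hw, sub_mulVec, sub_dotProduct]
  have h₃ : (A *ᵥ w) ⬝ᵥ w = (D *ᵥ w) ⬝ᵥ w - 2 * ((L *ᵥ w) ⬝ᵥ w) := by
    rw [hsplit, sub_mulVec, sub_mulVec, sub_dotProduct, sub_dotProduct,
      mulVec_dotProduct_eq Lᵀ, transpose_transpose, dotProduct_comm w]
    ring
  rw [mulVec_sub, sub_dotProduct, dotProduct_sub, dotProduct_sub, h₁, h₃]
  linarith

/-- If `(D - L) w = A z`, then `⟨A z, z⟩² ≤ ⟨D w, w⟩ ⟨(A + L D⁻¹ Lᵀ) z, z⟩`. -/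
lemma sq_energy_le [DecidableEq ι] {A D L : Matrix ι ι ℝ} (hD : D.PosDef)
    (hsplit : A = D - L - Lᵀ) {z w : ι → ℝ} (hw : (D - L) *ᵥ w = A *ᵥ z) :
    ((A *ᵥ z) ⬝ᵥ z) ^ 2 ≤
      ((D *ᵥ w) ⬝ᵥ w) * ((A *ᵥ z) ⬝ᵥ z + ((L * D⁻¹ * Lᵀ) *ᵥ z) ⬝ᵥ z) := by
  have hdet : IsUnit D.det := (isUnit_iff_isUnit_det D).1 hD.isUnit
  set p := D⁻¹ *ᵥ ((D - L)ᵀ *ᵥ z) with hp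
  have hDp : D *ᵥ p = (D - L)ᵀ *ᵥ z := by
    rw [hp, mulVec_mulVec, mul_nonsing_inv _ hdet, one_mulVec]
  have h₁ : (A *ᵥ z) ⬝ᵥ z = (D *ᵥ w) ⬝ᵥ p := by
    rw [← hw, mulVec_dotProduct_eq, ← hDp, mulVec_dotProduct_eq, hD.posSemidef.transpose_eq]
  have h₂ : (D *ᵥ p) ⬝ᵥ p = (A *ᵥ z) ⬝ᵥ z + ((L * D⁻¹ * Lᵀ) *ᵥ z) ⬝ᵥ z := by
    rw [← add_dotProduct, ← add_mulVec, ← splitting_mul_inv_mul_transpose hD hsplit,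
      ← mulVec_mulVec, ← mulVec_mulVec, ← hp, mulVec_dotProduct_eq (D - L), ← hDp, dotProduct_comm]
  rw [← h₂, h₁]
  exact hD.posSemidef.mulVec_dotProduct_sq_le w p

end Matrix

/-- The set of ratios `inf_{c ∈ N} ⟨S(u+c), u+c⟩ / ⟨𝒜 u, u⟩` over
nonzero `u ∈ N⊥` is (nonempty and) bounded above; with `K := 1 + sup` of this set,
`K ≥ 1`, the Gauss–Seidel-type error propagation matrix `E = I - (D - L)⁻¹ 𝒜`
satisfies `⟨𝒜 E v, E v⟩ ≤ (1 - 1/K) ⟨𝒜 v, v⟩` for every `v`, and the contraction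
factor obeys `√(1 - 1/K) < 1`. -/
theorem gauss_seidel_contraction (n : ℕ) (hn : 0 < n)
    (𝒜 D L : Matrix (Fin n) (Fin n) ℝ)
    (h𝒜 : 𝒜.PosSemidef) (hD : D.PosDef) (hDL : IsUnit (D - L))
    (hsplit : 𝒜 = D - L - Lᵀ) (h𝒜0 : 𝒜 ≠ 0) :
    let S := L * D⁻¹ * Lᵀ
    let E := (1 : Matrix (Fin n) (Fin n) ℝ) - (D - L)⁻¹ * 𝒜
    let N : Set (Fin n → ℝ) := {c | 𝒜.mulVec c = 0}
    let Nperp : Set (Fin n → ℝ) := {u | ∀ c ∈ N, u ⬝ᵥ c = 0}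
    let ratios : Set ℝ :=
      {r | ∃ u ∈ Nperp, u ≠ 0 ∧
        r = sInf {s | ∃ c ∈ N,
              s = (S.mulVec (u + c)) ⬝ᵥ (u + c) / ((𝒜.mulVec u) ⬝ᵥ u)}}
    let K := 1 + sSup ratios
    ratios.Nonempty ∧ BddAbove ratios ∧ 1 ≤ K ∧
      (∀ v : Fin n → ℝ,
        (𝒜.mulVec (E.mulVec v)) ⬝ᵥ (E.mulVec v) ≤ (1 - 1 / K) * ((𝒜.mulVec v) ⬝ᵥ v)) ∧
      Real.sqrt (1 - 1 / K) < 1 := by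
  intro S E N Nperp ratios K
  have hS : S.PosSemidef := by
    simpa using hD.posSemidef.inv.mul_mul_conjTranspose_same L
  have hnonneg : ∀ u c : Fin n → ℝ,
      0 ≤ (S *ᵥ (u + c)) ⬝ᵥ (u + c) / ((𝒜 *ᵥ u) ⬝ᵥ u) := fun u c ↦
    div_nonneg (hS.mulVec_dotProduct_nonneg _) (h𝒜.mulVec_dotProduct_nonneg _)
  have hne : ratios.Nonempty := by
    obtain ⟨x, hx⟩ : ∃ x, 𝒜 *ᵥ x ≠ 0 := by
      by_contra! h
      exact h𝒜0 (ext_of_mulVec_single fun i ↦ by simp only [h, zero_mulVec])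
    refine ⟨_, 𝒜 *ᵥ x, fun c hc ↦ ?_, hx, rfl⟩
    rw [mulVec_dotProduct_eq, h𝒜.transpose_eq, show 𝒜 *ᵥ c = 0 from hc, dotProduct_zero]
  have hbdd : BddAbove ratios := by
    obtain ⟨C, hC⟩ := h𝒜.exists_div_le S
    refine ⟨C, ?_⟩
    rintro _ ⟨u, hu, hu0, rfl⟩
    refine csInf_le_of_le ⟨0, ?_⟩ ⟨0, mulVec_zero 𝒜, rfl⟩ ?_
    · rintro _ ⟨c, -, rfl⟩
      exact hnonneg u c
    · simpa only [add_zero] using hC u hu hu0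
  have hK : 1 ≤ K := by
    refine le_add_of_nonneg_right (Real.sSup_nonneg ?_)
    rintro _ ⟨u, -, -, rfl⟩
    refine Real.sInf_nonneg ?_
    rintro _ ⟨c, -, rfl⟩
    exact hnonneg u c
  have hK0 : 0 < K := one_pos.trans_le hK
  refine ⟨hne, hbdd, hK, fun v ↦ ?_, ?_⟩
  · set w := (D - L)⁻¹ *ᵥ (𝒜 *ᵥ v) with hw_def
    have hw : (D - L) *ᵥ w = 𝒜 *ᵥ v := by
      rw [hw_def, mulVec_mulVec, mul_nonsing_inv _ ((isUnit_iff_isUnit_det _).1 hDL), one_mulVec]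
    have hE : E *ᵥ v = v - w := by
      simp only [E, sub_mulVec, one_mulVec, ← mulVec_mulVec, hw_def]
    rw [hE, mulVec_sub_dotProduct_sub h𝒜 hsplit hw]
    suffices h : (𝒜 *ᵥ v) ⬝ᵥ v ≤ ((D *ᵥ w) ⬝ᵥ w) * K by
      have := (div_le_iff₀ hK0).2 h
      rw [sub_mul, one_mul, one_div_mul_eq_div]
      linarith
    obtain ⟨u, c, hu, hc, rfl⟩ := 𝒜.exists_orthogonal_add_mulVec_eq_zero v
    have henergy : ∀ d, 𝒜 *ᵥ d = 0 → (𝒜 *ᵥ (u + d)) ⬝ᵥ (u + d) = (𝒜 *ᵥ u) ⬝ᵥ u := by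
      intro d hd
      rw [mulVec_add, hd, add_zero, dotProduct_add, mulVec_dotProduct_eq 𝒜 u d, h𝒜.transpose_eq,
        hd, dotProduct_zero, add_zero]
    rw [henergy c hc]
    have hδ : 0 ≤ (D *ᵥ w) ⬝ᵥ w := hD.posSemidef.mulVec_dotProduct_nonneg w
    rcases eq_or_ne u 0 with rfl | hu0
    · simpa using mul_nonneg hδ hK0.le
    have ha : 0 < (𝒜 *ᵥ u) ⬝ᵥ u := h𝒜.mulVec_dotProduct_pos hu hu0
    have hsq : ∀ d, 𝒜 *ᵥ d = 0 → ((𝒜 *ᵥ u) ⬝ᵥ u) ^ 2 ≤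
        ((D *ᵥ w) ⬝ᵥ w) * ((𝒜 *ᵥ u) ⬝ᵥ u + (S *ᵥ (u + d)) ⬝ᵥ (u + d)) := by
      intro d hd
      have h := sq_energy_le (z := u + d) hD hsplit (w := w) (by
        rw [hw, mulVec_add, mulVec_add, hc, hd])
      rwa [henergy d hd] at h
    have hδ0 : 0 < (D *ᵥ w) ⬝ᵥ w := by
      refine hδ.lt_of_ne' fun h ↦ ?_
      have := hsq 0 (mulVec_zero 𝒜)
      rw [h, zero_mul] at this
      exact (pow_pos ha 2).not_ge this
    rw [← div_le_iff₀' hδ0, ← sub_le_iff_le_add']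
    refine le_csSup_of_le hbdd ⟨u, hu, hu0, rfl⟩ (le_csInf ⟨_, 0, mulVec_zero 𝒜, rfl⟩ ?_)
    rintro _ ⟨d, hd, rfl⟩
    rw [sub_le_iff_le_add, div_add_one ha.ne', div_le_div_iff₀ hδ0 ha]
    linarith [hsq d hd]
  · rw [Real.sqrt_lt' one_pos]
    have : 0 < 1 / K := by positivity
    linarith
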